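/- Let q be a prime power. For every real number u with |u| < 1/q, the series ∑_{n=0}^∞ NG_n u^n / |GL(n,q)| converges, the family of factors (1 - u^i q^{-l})^{-1} indexed by pairs (i,l) with i ≥ 1 and l ≥ 1 is multipliable in ℝ, and ∑_{n=0}^∞ NG_n u^n / |GL(n,q)| = ∏_{i ≥ 1} ∏_{l ≥ 1} (1 - u^i q^{-l})^{-1}. -/

import Mathlib

/-- `|GL(n,q)| = ∏_{i=0}^{n-1} (q^n - q^i)`, as a real number. -/
noncomputable def glOrder (q n : ℕ) : ℝ :=
  ∏ i ∈ Finset.range n, ((q : ℝ) ^ n - (q : ℝ) ^ i)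

/-- `NG_n`: the number of ordered pairs of commuting nilpotent `n × n` matrices over `F`. -/
noncomputable def nilCommPairs (F : Type) [Field F] [Fintype F] (n : ℕ) : ℕ :=
  Nat.card {P : Matrix (Fin n) (Fin n) F × Matrix (Fin n) (Fin n) F //
    IsNilpotent P.1 ∧ IsNilpotent P.2 ∧ P.1 * P.2 = P.2 * P.1}

set_option linter.unusedSectionVars false

namespace FF

open Module

section Basic

variable {F : Type} [Field F]
variable {V W C S Y Z : Type} [AddCommGroup V] [Module F V] [AddCommGroup W] [Module F W]
  [AddCommGroup C] [Module F C] [AddCommGroup S] [Module F S]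
  [AddCommGroup Y] [Module F Y] [AddCommGroup Z] [Module F Z]

/-- block triangular endomorphism -/
def blk (a : W →ₗ[F] W) (b : C →ₗ[F] W) (d : C →ₗ[F] C) : End F (W × C) :=
  (a.coprod b).prod (d ∘ₗ LinearMap.snd F W C)

@[simp] lemma blk_apply (a : W →ₗ[F] W) (b : C →ₗ[F] W) (d : C →ₗ[F] C) (w : W) (c : C) :
    blk a b d (w, c) = (a w + b c, d c) := rfl

lemma blk_mul (a a' : End F W) (b b' : C →ₗ[F] W) (d d' : End F C) :
    blk a b d * blk a' b' d' = blk (a * a') (a ∘ₗ b' + b ∘ₗ d') (d * d') := by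
  ext x <;> simp

lemma blk_inj {a a' : End F W} {b b' : C →ₗ[F] W} {d d' : End F C} :
    blk a b d = blk a' b' d' ↔ a = a' ∧ b = b' ∧ d = d' := by
  constructor
  · intro h
    refine ⟨?_, ?_, ?_⟩
    · ext w
      have := congrArg Prod.fst (LinearMap.congr_fun h (w, 0))
      simpa using this
    · ext c
      have := congrArg Prod.fst (LinearMap.congr_fun h (0, c))
      simpa using this
    · ext c
      have := congrArg Prod.snd (LinearMap.congr_fun h (0, c))
      simpa using this
  · rintro ⟨rfl, rfl, rfl⟩; rfl

lemma exists_blk (T : End F (W × C)) (h : ∀ w, (T (w, 0)).2 = 0) :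
    ∃ a b d, T = blk a b d := by
  refine ⟨LinearMap.fst F W C ∘ₗ T ∘ₗ LinearMap.inl F W C,
    LinearMap.fst F W C ∘ₗ T ∘ₗ LinearMap.inr F W C,
    LinearMap.snd F W C ∘ₗ T ∘ₗ LinearMap.inr F W C, ?_⟩
  have h0 : T (0, 0) = 0 := T.map_zero
  ext x <;> simp [h, h0]

lemma blk_pow (a : End F W) (b : C →ₗ[F] W) (d : End F C) (k : ℕ) :
    ∃ b', (blk a b d) ^ k = blk (a ^ k) b' (d ^ k) := by
  induction k with
  | zero => exact ⟨0, by ext <;> simp⟩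
  | succ k ih =>
    obtain ⟨b', hb⟩ := ih
    exact ⟨_, by rw [pow_succ, hb, blk_mul, ← pow_succ, ← pow_succ]⟩

lemma blk_zero : blk (0 : End F W) (0 : C →ₗ[F] W) (0 : End F C) = 0 := by
  ext <;> simp

lemma blk_nilp (a : End F W) (b : C →ₗ[F] W) (d : End F C) :
    IsNilpotent (blk a b d) ↔ IsNilpotent a ∧ IsNilpotent d := by
  constructor
  · rintro ⟨k, hk⟩
    obtain ⟨b', hb⟩ := blk_pow a b d k
    rw [hb, ← blk_zero, blk_inj] at hk
    exact ⟨⟨k, hk.1⟩, ⟨k, hk.2.2⟩⟩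
  · rintro ⟨⟨i, hi⟩, ⟨j, hj⟩⟩
    obtain ⟨b', hb⟩ := blk_pow a b d i
    obtain ⟨b'', hb'⟩ := blk_pow a b d j
    refine ⟨i + j, ?_⟩
    rw [pow_add, hb, hb', blk_mul, hi, hj, ← blk_zero]
    simp

lemma pow_finrank_of_nilp [FiniteDimensional F V] {T : End F V} (h : IsNilpotent T) {n : ℕ}
    (hn : finrank F V ≤ n) : T ^ n = 0 := by
  obtain ⟨k, hk⟩ := h
  have h1 := Module.End.ker_pow_le_ker_pow_finrank T k
  rw [hk, LinearMap.ker_zero, top_le_iff, LinearMap.ker_eq_top] at h1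
  exact pow_eq_zero_of_le hn h1

end Basic

section Count

variable {F : Type} [Field F] [Fintype F]
variable {V W C S Y Z : Type} [AddCommGroup V] [Module F V] [AddCommGroup W] [Module F W]
  [AddCommGroup C] [Module F C] [AddCommGroup S] [Module F S]
  [AddCommGroup Y] [Module F Y] [AddCommGroup Z] [Module F Z]
  [FiniteDimensional F V] [FiniteDimensional F W] [FiniteDimensional F C] [FiniteDimensional F S]
  [FiniteDimensional F Y] [FiniteDimensional F Z]

variable (F) in
lemma finV (V : Type) [AddCommGroup V] [Module F V] [FiniteDimensional F V] : Finite V :=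
  Module.finite_of_finite F

lemma card_hom : Nat.card (V →ₗ[F] W) = Fintype.card F ^ (finrank F V * finrank F W) := by
  rw [Module.natCard_eq_pow_finrank (K := F), Module.finrank_linearMap, Nat.card_eq_fintype_card]

/-- constant fibres -/
lemma card_fib {X B : Type} [Finite X] [Finite B] (f : X → B) (c : ℕ)
    (h : ∀ b, Nat.card {x // f x = b} = c) : Nat.card X = Nat.card B * c := by
  have := Fintype.ofFinite B
  rw [← Nat.card_congr (Equiv.sigmaFiberEquiv f), Nat.card_sigma]
  simp [h]

lemma card_lift (f : Y →ₗ[F] Z) (g : C →ₗ[F] Z) (h : LinearMap.range g ≤ LinearMap.range f) :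
    Nat.card {b : C →ₗ[F] Y // f ∘ₗ b = g} = Fintype.card F ^ (finrank F C * finrank F (LinearMap.ker f)) := by
  obtain ⟨b0, hb0⟩ := Module.projective_lifting_property f.rangeRestrict
    (g.codRestrict (LinearMap.range f) (fun c => h ⟨c, rfl⟩)) f.surjective_rangeRestrict
  have hb1 : ∀ c, f (b0 c) = g c := fun c => by
    have := congrArg Subtype.val (LinearMap.congr_fun hb0 c)
    simpa using this
  rw [← card_hom]
  refine Nat.card_congr ⟨fun b => (b.1 - b0).codRestrict _ (fun c => ?_),
    fun k => ⟨b0 + (LinearMap.ker f).subtype ∘ₗ k, ?_⟩, ?_, ?_⟩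
  · have := LinearMap.congr_fun b.2 c
    simp at this
    simp [this, hb1]
  · ext c
    simp [hb1]
  · intro b
    ext c
    simp
  · intro k
    ext c
    simp

lemma card_li (k : ℕ) : Nat.card {s : Fin k → V // LinearIndependent F s} =
    ∏ i ∈ Finset.range k, (Fintype.card F ^ finrank F V - Fintype.card F ^ i) := by
  have := finV F V
  rcases le_or_gt k (finrank F V) with h | h
  · rw [card_linearIndependent h, Finset.prod_range]
  · rw [Finset.prod_eq_zero (i := finrank F V) (by simpa using h) (by simp)]
    rw [Nat.card_eq_zero]
    left
    constructor
    rintro ⟨s, hs⟩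
    have := hs.fintype_card_le_finrank
    simp at this
    omega

lemma card_inj : Nat.card {f : V →ₗ[F] W // Function.Injective f} =
    ∏ i ∈ Finset.range (finrank F V), (Fintype.card F ^ finrank F W - Fintype.card F ^ i) := by
  rw [← card_li]
  let e := (finBasis F V)
  refine Nat.card_congr (((e.constr F).toEquiv.subtypeEquiv (fun s => ?_)).symm)
  constructor
  · intro h
    show Function.Injective (e.constr F s)
    rw [← LinearMap.ker_eq_bot, LinearMap.ker_eq_bot']
    intro x hx
    rw [Basis.constr_apply_fintype] at hx
    have := Fintype.linearIndependent_iff.1 h _ hx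
    apply e.equivFun.injective
    ext i
    simpa using this i
  · intro h
    have h3 := e.linearIndependent.map' (e.constr F s) (LinearMap.ker_eq_bot.2 h)
    have e2 : s = (e.constr F s) ∘ e := by ext i; simp
    rw [e2]
    exact h3

lemma card_surj : Nat.card {f : V →ₗ[F] W // Function.Surjective f} =
    ∏ i ∈ Finset.range (finrank F W), (Fintype.card F ^ finrank F V - Fintype.card F ^ i) := by
  have := card_inj (F := F) (V := Dual F W) (W := Dual F V)
  rw [Subspace.dual_finrank_eq, Subspace.dual_finrank_eq] at this
  rw [← this]
  have hb : Function.Bijective (Dual.transpose (R := F) (M := V) (M' := W)) := by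
    have hi : Function.Injective (Dual.transpose (R := F) (M := V) (M' := W)) := by
      intro f g h
      ext v
      rw [← sub_eq_zero, ← Module.forall_dual_apply_eq_zero_iff F]
      intro φ
      have := LinearMap.congr_fun (LinearMap.congr_fun h φ) v
      simp only [Dual.transpose_apply, LinearMap.comp_apply] at this
      rw [map_sub, this, sub_self]
    have := finV F (Dual F W →ₗ[F] Dual F V)
    refine (Nat.bijective_iff_injective_and_card _).2 ⟨hi, ?_⟩
    rw [card_hom, card_hom, Subspace.dual_finrank_eq, Subspace.dual_finrank_eq, mul_comm]
  refine Nat.card_congr ((Equiv.ofBijective _ hb).subtypeEquiv (fun f => ?_))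
  exact (LinearMap.dualMap_injective_iff).symm

lemma card_gr (k : ℕ) : Nat.card {U : Submodule F V // finrank F U = k} *
    ∏ i ∈ Finset.range k, (Fintype.card F ^ k - Fintype.card F ^ i) = ∏ i ∈ Finset.range k, (Fintype.card F ^ finrank F V - Fintype.card F ^ i) := by
  have := finV F V
  have : Finite (Submodule F V) := Finite.of_injective _ SetLike.coe_injective
  rw [← card_li]
  symm
  refine card_fib (fun s : {s : Fin k → V // LinearIndependent F s} =>
    (⟨Submodule.span F (Set.range s.1), by simp [finrank_span_eq_card s.2]⟩ :
      {U : Submodule F V // finrank F U = k})) _ ?_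
  rintro ⟨U, hU⟩
  have := card_li (F := F) (V := U) k
  rw [hU] at this
  rw [← this]
  symm
  refine Nat.card_congr ⟨fun s => ⟨⟨fun i => (s.1 i : V), ?_⟩, ?_⟩,
    fun s => ⟨fun i => ⟨s.1.1 i, ?_⟩, ?_⟩, ?_, ?_⟩
  · exact s.2.map' U.subtype (by simp)
  · apply Subtype.ext
    apply Submodule.eq_of_le_of_finrank_eq
    · rw [Submodule.span_le]
      rintro _ ⟨i, rfl⟩
      exact (s.1 i).2
    · have h1 : LinearIndependent F (fun i => (s.1 i : V)) := s.2.map' U.subtype (by simp)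
      have h2 := finrank_span_eq_card h1
      simpa [hU] using h2
  · have := congrArg Subtype.val s.2
    simp only at this
    exact this.le (Submodule.subset_span ⟨i, rfl⟩)
  · exact LinearIndependent.of_comp U.subtype s.1.2
  · intro s; rfl
  · intro s; rfl

end Count
end FF

namespace FF

open Module

section Count2

variable {F : Type} [Field F] [Fintype F]
variable {V V' W C S : Type} [AddCommGroup V] [Module F V] [AddCommGroup W] [Module F W]
  [AddCommGroup V'] [Module F V'] [AddCommGroup C] [Module F C] [AddCommGroup S] [Module F S]
  [FiniteDimensional F V] [FiniteDimensional F V']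
  [FiniteDimensional F W] [FiniteDimensional F C] [FiniteDimensional F S]

variable (F) in
/-- number of nilpotent endomorphisms -/
noncomputable def nilc (k : ℕ) : ℕ := Nat.card {d : End F (Fin k → F) // IsNilpotent d}

lemma card_nil_congr (e : V ≃ₗ[F] V') : Nat.card {d : End F V // IsNilpotent d} =
    Nat.card {d : End F V' // IsNilpotent d} :=
  Nat.card_congr (e.conjRingEquiv.toEquiv.subtypeEquiv
    (fun d => (IsNilpotent.map_iff e.conjRingEquiv.injective).symm))

lemma card_nil : Nat.card {d : End F V // IsNilpotent d} = nilc F (finrank F V) :=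
  card_nil_congr (finBasis F V).equivFun

lemma exists_split (U : Submodule F V) : ∃ (C : Submodule F V) (e : V ≃ₗ[F] U × C),
    U.map e.toLinearMap = LinearMap.range (LinearMap.inl F U C) ∧
    finrank F U + finrank F C = finrank F V := by
  obtain ⟨C, hC⟩ := Submodule.exists_isCompl U
  refine ⟨C, (U.prodEquivOfIsCompl C hC).symm, ?_, Submodule.finrank_add_eq_of_isCompl hC⟩
  ext x
  simp only [Submodule.mem_map, LinearMap.mem_range]
  constructor
  · rintro ⟨y, hy, rfl⟩
    exact ⟨⟨y, hy⟩, (Submodule.prodEquivOfIsCompl_symm_apply_left U C hC ⟨y, hy⟩).symm⟩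
  · rintro ⟨y, rfl⟩
    exact ⟨y, y.2, (Submodule.prodEquivOfIsCompl_symm_apply_left U C hC y)⟩

lemma range_conj (e : V ≃ₗ[F] V') (T : End F V) :
    LinearMap.range (e.conjRingEquiv T) = (LinearMap.range T).map e.toLinearMap := by
  ext x
  simp only [Submodule.mem_map, LinearMap.mem_range]
  constructor
  · rintro ⟨y, rfl⟩
    exact ⟨T (e.symm y), ⟨_, rfl⟩, by simp⟩
  · rintro ⟨_, ⟨y, rfl⟩, rfl⟩
    exact ⟨e y, by simp⟩

lemma mem_range_inl {x : W × C} : x ∈ LinearMap.range (LinearMap.inl F W C) ↔ x.2 = 0 := by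
  constructor
  · rintro ⟨y, rfl⟩; simp
  · intro h
    exact ⟨x.1, by ext <;> simp [h]⟩

lemma range_pow_succ (T : End F V) :
    LinearMap.range (T ^ (finrank F V + 1)) = LinearMap.range (T ^ finrank F V) := by
  apply Submodule.eq_of_le_of_finrank_eq
  · rw [pow_succ]
    exact LinearMap.range_comp_le_range _ _
  · have h1 := LinearMap.finrank_range_add_finrank_ker (T ^ (finrank F V + 1))
    have h2 := LinearMap.finrank_range_add_finrank_ker (T ^ (finrank F V))
    have h3 := Module.End.ker_pow_eq_ker_pow_finrank_of_le (f := T) (Nat.le_succ (finrank F V))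
    rw [Nat.succ_eq_add_one] at h3
    rw [h3] at h1
    omega

lemma range_blk_pow (T : End F (W × C)) :
    LinearMap.range (T ^ finrank F (W × C)) = LinearMap.range (LinearMap.inl F W C) ↔
    ∃ (a : End F W) (b : C →ₗ[F] W) (d : End F C),
      Function.Surjective a ∧ IsNilpotent d ∧ T = blk a b d := by
  set n := finrank F (W × C) with hn
  constructor
  · intro h
    have hTW : (LinearMap.range (LinearMap.inl F W C)).map T =
        LinearMap.range (LinearMap.inl F W C) := by
      rw [← h, ← LinearMap.range_comp, ← Module.End.mul_eq_comp, ← pow_succ', hn, range_pow_succ]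
    obtain ⟨a, b, d, rfl⟩ := exists_blk T (fun w => by
      rw [← mem_range_inl (F := F), ← hTW]
      exact ⟨(w, 0), ⟨w, rfl⟩, rfl⟩)
    refine ⟨a, b, d, ?_, ?_, rfl⟩
    · intro w
      have : (w, (0 : C)) ∈ LinearMap.range (LinearMap.inl F W C) := ⟨w, rfl⟩
      rw [← hTW] at this
      obtain ⟨_, ⟨x, rfl⟩, hx⟩ := this
      exact ⟨x, by simpa using congrArg Prod.fst hx⟩
    · obtain ⟨b', hb⟩ := blk_pow a b d n
      refine ⟨n, ?_⟩
      ext c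
      have : (blk a b d ^ n) (0, c) ∈ LinearMap.range (LinearMap.inl F W C) := by
        rw [← h]; exact ⟨_, rfl⟩
      rw [mem_range_inl, hb] at this
      simpa using this
  · rintro ⟨a, b, d, ha, hd, rfl⟩
    obtain ⟨b', hb⟩ := blk_pow a b d n
    have hdn : d ^ n = 0 := pow_finrank_of_nilp hd (by rw [hn, Module.finrank_prod]; omega)
    have han : Function.Surjective (a ^ n : End F W) := by
      rw [Module.End.coe_pow]; exact ha.iterate n
    rw [hb, hdn]
    ext x
    rw [mem_range_inl]
    constructor
    · rintro ⟨y, rfl⟩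
      rfl
    · intro hx
      obtain ⟨w, hw⟩ := han x.1
      exact ⟨(w, 0), by ext <;> simp [hw, hx]⟩

lemma card_fit_prod : Nat.card {T : End F (W × C) //
    LinearMap.range (T ^ finrank F (W × C)) = LinearMap.range (LinearMap.inl F W C)} =
    (∏ i ∈ Finset.range (finrank F W), (Fintype.card F ^ finrank F W - Fintype.card F ^ i)) *
    (Fintype.card F ^ (finrank F C * finrank F W) * nilc F (finrank F C)) := by
  rw [← card_surj (V := W), ← card_hom, ← card_nil, ← Nat.card_prod, ← Nat.card_prod]
  symm
  refine Nat.card_congr (Equiv.ofBijective (fun p => ⟨blk p.1.1 p.2.1 p.2.2.1,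
    (range_blk_pow _).2 ⟨_, _, _, p.1.2, p.2.2.2, rfl⟩⟩) ⟨?_, ?_⟩)
  · rintro ⟨⟨a, ha⟩, b, ⟨d, hd⟩⟩ ⟨⟨a', ha'⟩, b', ⟨d', hd'⟩⟩ h
    have h := blk_inj.1 (congrArg Subtype.val h)
    simp only at h
    obtain ⟨rfl, rfl, rfl⟩ := h
    rfl
  · rintro ⟨T, hT⟩
    obtain ⟨a, b, d, ha, hd, rfl⟩ := (range_blk_pow _).1 hT
    exact ⟨⟨⟨a, ha⟩, b, ⟨d, hd⟩⟩, rfl⟩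

lemma card_fit (U : Submodule F V) {k j : ℕ} (hU : finrank F U = k) (hV : finrank F V = k + j) :
    Nat.card {T : End F V // LinearMap.range (T ^ finrank F V) = U} =
    (∏ i ∈ Finset.range k, (Fintype.card F ^ k - Fintype.card F ^ i)) *
    (Fintype.card F ^ (j * k) * nilc F j) := by
  obtain ⟨C, e, he, hf⟩ := exists_split U
  have hC : finrank F C = j := by omega
  have := card_fit_prod (F := F) (W := U) (C := C)
  rw [hU, hC] at this
  rw [← this]
  refine Nat.card_congr (e.conjRingEquiv.toEquiv.subtypeEquiv (fun T => ?_))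
  show _ ↔ LinearMap.range ((e.conjRingEquiv T) ^ _) = _
  rw [← map_pow, range_conj, ← he, e.finrank_eq]
  exact (Submodule.map_injective_of_injective e.injective).eq_iff.symm

/-- Fitting decomposition count -/
lemma fit_total (n : ℕ) : Fintype.card F ^ (n * n) = ∑ k ∈ Finset.range (n + 1),
    Nat.card {U : Submodule F (Fin n → F) // finrank F U = k} *
    ((∏ i ∈ Finset.range k, (Fintype.card F ^ k - Fintype.card F ^ i)) *
    (Fintype.card F ^ ((n - k) * k) * nilc F (n - k))) := by
  classical
  have hfV := finV F (Fin n → F)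
  have hfE := finV F (End F (Fin n → F))
  have hfS : Finite (Submodule F (Fin n → F)) := Finite.of_injective _ SetLike.coe_injective
  have := Fintype.ofFinite (Submodule F (Fin n → F))
  have hn : finrank F (Fin n → F) = n := by simp
  have h1 := card_hom (F := F) (V := Fin n → F) (W := Fin n → F)
  rw [hn] at h1
  rw [← h1, ← Nat.card_congr (Equiv.sigmaFiberEquiv
    (fun T : End F (Fin n → F) => LinearMap.range (T ^ finrank F (Fin n → F)))), Nat.card_sigma]
  rw [← Finset.sum_fiberwise_of_maps_to (t := Finset.range (n + 1))
    (g := fun U : Submodule F (Fin n → F) => finrank F U)]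
  · apply Finset.sum_congr rfl
    intro k hk
    rw [Finset.mem_range] at hk
    rw [Finset.sum_congr rfl (g := fun _ => ((∏ i ∈ Finset.range k,
      (Fintype.card F ^ k - Fintype.card F ^ i)) *
      (Fintype.card F ^ ((n - k) * k) * nilc F (n - k))))]
    · rw [Finset.sum_const, smul_eq_mul, Nat.card_eq_fintype_card, Fintype.card_subtype]
    · intro U hU
      exact card_fit U (Finset.mem_filter.1 hU).2 (by omega)
  · intro U _
    have := Submodule.finrank_le U
    simp at *
    omega

end Count2
end FF

namespace FF

open Module

section Count3

variable {F : Type} [Field F] [Fintype F]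
variable {V V' W C S : Type} [AddCommGroup V] [Module F V] [AddCommGroup W] [Module F W]
  [AddCommGroup V'] [Module F V'] [AddCommGroup C] [Module F C] [AddCommGroup S] [Module F S]
  [FiniteDimensional F V] [FiniteDimensional F V']
  [FiniteDimensional F W] [FiniteDimensional F C] [FiniteDimensional F S]

/-- nilpotent commuting pair -/
def PairOK (P : End F V × End F V) : Prop :=
  IsNilpotent P.1 ∧ IsNilpotent P.2 ∧ P.1 * P.2 = P.2 * P.1

lemma card_nil_over_snd (E : End F S) (hE : IsNilpotent E) :
    Nat.card {d : End F (C × S) // IsNilpotent d ∧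
      LinearMap.snd F C S ∘ₗ d = E ∘ₗ LinearMap.snd F C S} =
    Fintype.card F ^ (finrank F S * finrank F C) * nilc F (finrank F C) := by
  rw [← card_nil, ← card_hom, ← Nat.card_prod]
  symm
  refine Nat.card_congr (Equiv.ofBijective (fun p => ⟨blk p.2.1 p.1 E,
    (blk_nilp _ _ _).2 ⟨p.2.2, hE⟩, by ext <;> simp⟩) ⟨?_, ?_⟩)
  · rintro ⟨b, a, ha⟩ ⟨b', a', ha'⟩ h
    have h := blk_inj.1 (congrArg Subtype.val h)
    simp only at h
    obtain ⟨rfl, rfl, -⟩ := h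
    rfl
  · rintro ⟨d, hd, hd2⟩
    obtain ⟨a, b, x, rfl⟩ := exists_blk d (fun w => by
      have := LinearMap.congr_fun hd2 (w, 0)
      simpa using this)
    have hx : x = E := by
      ext c
      simpa using LinearMap.congr_fun hd2 (0, c)
    subst hx
    exact ⟨⟨b, a, ((blk_nilp _ _ _).1 hd).1⟩, rfl⟩

lemma card_nil_over (α : C →ₗ[F] S) (hα : Function.Surjective α) (E : End F S)
    (hE : IsNilpotent E) :
    Nat.card {d : End F C // IsNilpotent d ∧ α ∘ₗ d = E ∘ₗ α} =
    Fintype.card F ^ (finrank F S * (finrank F C - finrank F S)) *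
      nilc F (finrank F C - finrank F S) := by
  obtain ⟨σ, hσ⟩ := α.exists_rightInverse_of_surjective (LinearMap.range_eq_top.2 hα)
  have hσ' : ∀ t, α (σ t) = t := fun t => LinearMap.congr_fun hσ t
  have hk : finrank F (LinearMap.ker α) = finrank F C - finrank F S := by
    have := LinearMap.finrank_range_add_finrank_ker α
    rw [LinearMap.range_eq_top.2 hα, finrank_top] at this
    omega
  let f : (LinearMap.ker α × S) →ₗ[F] C := (LinearMap.ker α).subtype.coprod σ
  have hf : Function.Bijective f := by
    constructor
    · rw [← LinearMap.ker_eq_bot, LinearMap.ker_eq_bot']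
      rintro ⟨k, t⟩ h
      have h1 : (k : C) + σ t = 0 := h
      have h2 := congrArg α h1
      rw [map_add, hσ', map_zero, LinearMap.mem_ker.1 k.2, zero_add] at h2
      subst h2
      simp at h1
      simp [h1]
    · intro c
      refine ⟨(⟨c - σ (α c), by simp [hσ']⟩, α c), ?_⟩
      simp [f]
  let e := LinearEquiv.ofBijective f hf
  have hαe : ∀ x, α (e x) = x.2 := by
    rintro ⟨k, t⟩
    show α ((k : C) + σ t) = t
    rw [map_add, hσ', LinearMap.mem_ker.1 k.2, zero_add]
  have hαe' : ∀ c, (e.symm c).2 = α c := fun c => by rw [← hαe]; simp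
  rw [← hk, ← card_nil_over_snd E hE]
  refine Nat.card_congr (e.symm.conjRingEquiv.toEquiv.subtypeEquiv
    (fun d => and_congr (IsNilpotent.map_iff e.symm.conjRingEquiv.injective).symm ?_))
  constructor
  · intro h
    apply LinearMap.ext
    intro x
    have := LinearMap.congr_fun h (e x)
    simp only [LinearMap.comp_apply, hαe] at this
    simp [hαe', this]
  · intro h
    apply LinearMap.ext
    intro x
    have := LinearMap.congr_fun h (e.symm x)
    simpa [hαe'] using this

/-- the extension data -/
def ExtOK (A B : End F W) (t : (C →ₗ[F] W) × (C →ₗ[F] W) × End F C) : Prop :=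
  LinearMap.range A ⊔ LinearMap.range t.1 = ⊤ ∧ A ∘ₗ t.2.1 + t.1 ∘ₗ t.2.2 = B ∘ₗ t.1 ∧
    IsNilpotent t.2.2

lemma card_ext_aux (A B : End F W) (π : W →ₗ[F] S) (hπ : Function.Surjective π)
    (hker : LinearMap.ker π = LinearMap.range A) (E : End F S) (hE : IsNilpotent E)
    (hEq : ∀ x, E (π x) = π (B x))
    (hS : finrank F S = finrank F (LinearMap.ker A)) :
    Nat.card {t : (C →ₗ[F] W) × (C →ₗ[F] W) × End F C // ExtOK A B t} =
    (∏ i ∈ Finset.range (finrank F (LinearMap.ker A)),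
      (Fintype.card F ^ finrank F C - Fintype.card F ^ i)) *
    (Fintype.card F ^ (finrank F (LinearMap.ker A) * (finrank F C - finrank F (LinearMap.ker A))) *
      nilc F (finrank F C - finrank F (LinearMap.ker A))) *
    Fintype.card F ^ (finrank F C * finrank F (LinearMap.range A)) *
    Fintype.card F ^ (finrank F C * finrank F (LinearMap.ker A)) := by
  have f1 := finV F (C →ₗ[F] W)
  have f2 := finV F (End F C)
  have f3 := finV F (C →ₗ[F] S)
  let T3 := {α : C →ₗ[F] S // Function.Surjective α}
  let T2 := {t : (C →ₗ[F] S) × End F C // Function.Surjective t.1 ∧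
    IsNilpotent t.2 ∧ t.1 ∘ₗ t.2 = E ∘ₗ t.1}
  let T1 := {t : (C →ₗ[F] W) × End F C // Function.Surjective (π ∘ₗ t.1) ∧
    IsNilpotent t.2 ∧ (π ∘ₗ t.1) ∘ₗ t.2 = E ∘ₗ (π ∘ₗ t.1)}
  have hsurj : ∀ a : C →ₗ[F] W, Function.Surjective (π ∘ₗ a) ↔
      LinearMap.range A ⊔ LinearMap.range a = ⊤ := by
    intro a
    rw [← LinearMap.range_eq_top, LinearMap.range_comp,
      LinearMap.map_eq_top_iff (LinearMap.range_eq_top.2 hπ), hker, sup_comm]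
  have h3 : Nat.card T3 = ∏ i ∈ Finset.range (finrank F (LinearMap.ker A)),
      (Fintype.card F ^ finrank F C - Fintype.card F ^ i) := by
    rw [← hS]; exact card_surj
  have h2 : Nat.card T2 = Nat.card T3 * (Fintype.card F ^ (finrank F (LinearMap.ker A) *
      (finrank F C - finrank F (LinearMap.ker A))) *
      nilc F (finrank F C - finrank F (LinearMap.ker A))) := by
    refine card_fib (fun t : T2 => (⟨t.1.1, t.2.1⟩ : T3)) _ ?_
    rintro ⟨α, hα⟩
    rw [← hS, ← card_nil_over α hα E hE]
    refine Nat.card_congr ⟨fun t => ⟨t.1.1.2, ?_⟩, fun d => ⟨⟨(α, d.1), hα, d.2⟩, rfl⟩, ?_, ?_⟩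
    · obtain ⟨⟨⟨α', d⟩, h⟩, h'⟩ := t
      have : α' = α := congrArg Subtype.val h'
      subst this
      exact h.2
    · rintro ⟨⟨⟨α', d⟩, h⟩, h'⟩
      have : α' = α := congrArg Subtype.val h'
      subst this
      rfl
    · intro d; rfl
  have h1 : Nat.card T1 = Nat.card T2 *
      Fintype.card F ^ (finrank F C * finrank F (LinearMap.range A)) := by
    refine card_fib (fun t : T1 => (⟨(π ∘ₗ t.1.1, t.1.2), t.2⟩ : T2)) _ ?_
    rintro ⟨⟨α, d⟩, h⟩
    have hl := card_lift π α (by rw [LinearMap.range_eq_top.2 hπ]; exact le_top)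
    rw [hker] at hl
    rw [← hl]
    refine Nat.card_congr ⟨fun t => ⟨t.1.1.1, ?_⟩, fun a => ⟨⟨(a.1, d), ?_⟩, ?_⟩, ?_, ?_⟩
    · exact congrArg (fun x => x.1.1) t.2
    · obtain ⟨a, rfl⟩ := a; exact h
    · obtain ⟨a, rfl⟩ := a; rfl
    · rintro ⟨⟨⟨a, d'⟩, h⟩, h'⟩
      have : d' = d := congrArg (fun x => x.1.2) h'
      subst this
      rfl
    · intro a; rfl
  rw [← h3, ← h2, ← h1]
  have key : ∀ t : (C →ₗ[F] W) × (C →ₗ[F] W) × End F C, ExtOK A B t →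
      Function.Surjective (π ∘ₗ t.1) ∧
      IsNilpotent t.2.2 ∧ (π ∘ₗ t.1) ∘ₗ t.2.2 = E ∘ₗ (π ∘ₗ t.1) := by
    rintro ⟨a, b, d⟩ ⟨h1, h2, h3⟩
    refine ⟨(hsurj a).2 h1, h3, ?_⟩
    ext c
    have := congrArg π (LinearMap.congr_fun h2 c)
    simp only [LinearMap.add_apply, LinearMap.comp_apply, map_add] at this ⊢
    rw [hEq, ← this]
    have h0 : π (A (b c)) = 0 := by
      rw [← LinearMap.mem_ker, hker]
      exact ⟨_, rfl⟩
    rw [h0, zero_add]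
  refine card_fib (fun t : {t : (C →ₗ[F] W) × (C →ₗ[F] W) × End F C // ExtOK A B t} =>
    (⟨(t.1.1, t.1.2.2), key t.1 t.2⟩ : T1)) _ ?_
  rintro ⟨⟨a, d⟩, hs, hd, had⟩
  simp only at hs hd had
  rw [← card_lift A (B ∘ₗ a - a ∘ₗ d) ?_]
  · refine Nat.card_congr ⟨fun t => ⟨t.1.1.2.1, ?_⟩,
      fun b => ⟨⟨(a, b.1, d), (hsurj a).1 hs, ?_, hd⟩, rfl⟩, ?_, ?_⟩
    · obtain ⟨⟨⟨a', b, d'⟩, h⟩, h'⟩ := t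
      have e1 : a' = a := congrArg (fun x => x.1.1) h'
      have e2 : d' = d := congrArg (fun x => x.1.2) h'
      subst e1 e2
      exact eq_sub_of_add_eq h.2.1
    · simp [b.2]
    · rintro ⟨⟨⟨a', b, d'⟩, h⟩, h'⟩
      have e1 : a' = a := congrArg (fun x => x.1.1) h'
      have e2 : d' = d := congrArg (fun x => x.1.2) h'
      subst e1 e2
      rfl
    · intro b; rfl
  · rintro _ ⟨c, rfl⟩
    have := LinearMap.congr_fun had c
    simp only [LinearMap.comp_apply] at this
    rw [hEq] at this
    rw [← hker, LinearMap.mem_ker]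
    simp only [LinearMap.sub_apply, LinearMap.comp_apply]
    rw [map_sub, this, sub_self]

lemma card_ext (A B : End F W) (hAB : PairOK (A, B)) :
    Nat.card {t : (C →ₗ[F] W) × (C →ₗ[F] W) × End F C // ExtOK A B t} =
    (∏ i ∈ Finset.range (finrank F (LinearMap.ker A)),
      (Fintype.card F ^ finrank F C - Fintype.card F ^ i)) *
    (Fintype.card F ^ (finrank F (LinearMap.ker A) * (finrank F C - finrank F (LinearMap.ker A))) *
      nilc F (finrank F C - finrank F (LinearMap.ker A))) *
    Fintype.card F ^ (finrank F C * finrank F (LinearMap.range A)) *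
    Fintype.card F ^ (finrank F C * finrank F (LinearMap.ker A)) := by
  obtain ⟨hA, hB, hcomm⟩ := hAB
  simp only at hA hB hcomm
  have hcomm' : ∀ x, A (B x) = B (A x) := fun x => LinearMap.congr_fun hcomm x
  have hRB : LinearMap.range A ≤ (LinearMap.range A).comap B := by
    rintro _ ⟨x, rfl⟩
    exact ⟨B x, hcomm' x⟩
  have hS : finrank F (W ⧸ LinearMap.range A) = finrank F (LinearMap.ker A) := by
    have h1 := Submodule.finrank_quotient_add_finrank (LinearMap.range A)
    have h2 := LinearMap.finrank_range_add_finrank_ker A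
    omega
  refine card_ext_aux A B (LinearMap.range A).mkQ (Submodule.mkQ_surjective _)
    (Submodule.ker_mkQ _) ((LinearMap.range A).mapQ (LinearMap.range A) B hRB) ?_
    (fun x => rfl) hS
  obtain ⟨k, hk⟩ := hB
  refine ⟨k, ?_⟩
  have key : ∀ j x, (((LinearMap.range A).mapQ (LinearMap.range A) B hRB) ^ j)
      ((LinearMap.range A).mkQ x) = (LinearMap.range A).mkQ ((B ^ j) x) := by
    intro j
    induction j with
    | zero => intro x; rfl
    | succ j ih =>
      intro x
      rw [pow_succ, pow_succ, Module.End.mul_apply, Module.End.mul_apply, ← ih]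
      rfl
  apply Submodule.linearMap_qext
  ext x
  rw [LinearMap.comp_apply, key, hk]
  simp

variable (F) in
/-- number of commuting nilpotent pairs with given kernel dimension of the first -/
noncomputable def hh (n r : ℕ) : ℕ := Nat.card {P : End F (Fin n → F) × End F (Fin n → F) //
  PairOK P ∧ finrank F (LinearMap.ker P.1) = r}

lemma pairOK_conj (e : V ≃ₗ[F] V') (P : End F V × End F V) :
    PairOK P ↔ PairOK (e.conjRingEquiv P.1, e.conjRingEquiv P.2) := by
  unfold PairOK
  simp only
  rw [IsNilpotent.map_iff e.conjRingEquiv.injective, IsNilpotent.map_iff e.conjRingEquiv.injective,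
    ← map_mul, ← map_mul, e.conjRingEquiv.injective.eq_iff]

lemma finrank_ker_iff (T : End F V) (r : ℕ) : finrank F (LinearMap.ker T) = r ↔
    finrank F (LinearMap.range T) + r = finrank F V := by
  have := LinearMap.finrank_range_add_finrank_ker T
  omega

lemma card_pair (r : ℕ) : Nat.card {P : End F V × End F V // PairOK P ∧
    finrank F (LinearMap.ker P.1) = r} = hh F (finrank F V) r := by
  let e := (finBasis F V).equivFun
  refine Nat.card_congr ((Equiv.prodCongr e.conjRingEquiv.toEquiv
    e.conjRingEquiv.toEquiv).subtypeEquiv (fun P => and_congr (pairOK_conj e P) ?_))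
  rw [finrank_ker_iff, finrank_ker_iff]
  show _ ↔ finrank F (LinearMap.range (e.conjRingEquiv P.1)) + r = _
  rw [range_conj, LinearEquiv.finrank_map_eq, ← e.finrank_eq]

end Count3
end FF

namespace FF

open Module

section Count4

variable {F : Type} [Field F] [Fintype F]
variable {V V' W C S : Type} [AddCommGroup V] [Module F V] [AddCommGroup W] [Module F W]
  [AddCommGroup V'] [Module F V'] [AddCommGroup C] [Module F C] [AddCommGroup S] [Module F S]
  [FiniteDimensional F V] [FiniteDimensional F V']
  [FiniteDimensional F W] [FiniteDimensional F C] [FiniteDimensional F S]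

variable (F) in
/-- number of extensions -/
noncomputable def extc (m r s : ℕ) : ℕ :=
  (∏ i ∈ Finset.range s, (Fintype.card F ^ r - Fintype.card F ^ i)) *
    (Fintype.card F ^ (s * (r - s)) * nilc F (r - s)) *
    Fintype.card F ^ (r * (m - s)) * Fintype.card F ^ (r * s)

lemma card_ext' (A B : End F W) (hAB : PairOK (A, B)) :
    Nat.card {t : (C →ₗ[F] W) × (C →ₗ[F] W) × End F C // ExtOK A B t} =
    extc F (finrank F W) (finrank F C) (finrank F (LinearMap.ker A)) := by
  rw [card_ext A B hAB, extc]
  have := LinearMap.finrank_range_add_finrank_ker A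
  rw [show finrank F W - finrank F (LinearMap.ker A) = finrank F (LinearMap.range A) by omega]

lemma range_blk_zero (A : End F W) (a : C →ₗ[F] W) :
    LinearMap.range (blk A a 0) = LinearMap.range (LinearMap.inl F W C) ↔
    LinearMap.range A ⊔ LinearMap.range a = ⊤ := by
  rw [← LinearMap.range_coprod, LinearMap.range_eq_top]
  constructor
  · intro h w
    have : (w, (0 : C)) ∈ LinearMap.range (LinearMap.inl F W C) := ⟨w, rfl⟩
    rw [← h] at this
    obtain ⟨⟨x, c⟩, hx⟩ := this
    exact ⟨(x, c), by simpa using congrArg Prod.fst hx⟩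
  · intro h
    ext x
    rw [mem_range_inl]
    constructor
    · rintro ⟨⟨x, c⟩, rfl⟩
      rfl
    · intro hx
      obtain ⟨⟨w, c⟩, hw⟩ := h x.1
      refine ⟨(w, c), ?_⟩
      simp only [LinearMap.coprod_apply] at hw
      ext <;> simp [hw, hx]

lemma pair_blk (A B : End F W) (t : (C →ₗ[F] W) × (C →ₗ[F] W) × End F C) :
    (PairOK (blk A t.1 0, blk B t.2.1 t.2.2) ∧
      LinearMap.range (blk A t.1 0) = LinearMap.range (LinearMap.inl F W C)) ↔
    PairOK (A, B) ∧ ExtOK A B t := by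
  obtain ⟨a, b, d⟩ := t
  unfold PairOK ExtOK
  simp only
  rw [range_blk_zero, blk_nilp, blk_nilp, blk_mul, blk_mul, blk_inj]
  simp only [zero_mul, mul_zero, LinearMap.comp_zero, add_zero, and_true, IsNilpotent.zero]
  tauto

lemma card_rp_prod_sigma :
    Nat.card {P : End F (W × C) × End F (W × C) // PairOK P ∧
      LinearMap.range P.1 = LinearMap.range (LinearMap.inl F W C)} =
    Nat.card (Σ P : {P : End F W × End F W // PairOK P},
      {t : (C →ₗ[F] W) × (C →ₗ[F] W) × End F C // ExtOK P.1.1 P.1.2 t}) := by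
  symm
  refine Nat.card_congr (Equiv.ofBijective (fun x =>
    ⟨(blk x.1.1.1 x.2.1.1 0, blk x.1.1.2 x.2.1.2.1 x.2.1.2.2),
      (pair_blk x.1.1.1 x.1.1.2 x.2.1).2 ⟨x.1.2, x.2.2⟩⟩) ⟨?_, ?_⟩)
  · rintro ⟨⟨⟨A, B⟩, h⟩, ⟨⟨a, b, d⟩, ht⟩⟩ ⟨⟨⟨A', B'⟩, h'⟩, ⟨⟨a', b', d'⟩, ht'⟩⟩ hx
    have hx := congrArg Subtype.val hx
    simp only [Prod.mk.injEq, blk_inj] at hx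
    obtain ⟨⟨rfl, rfl, -⟩, rfl, rfl, rfl⟩ := hx
    rfl
  · rintro ⟨⟨A, B⟩, hAB, hr⟩
    simp only at hr
    obtain ⟨A, a, z, rfl⟩ := exists_blk A (fun w => by
      rw [← mem_range_inl (F := F), ← hr]
      exact ⟨_, rfl⟩)
    have hz : z = 0 := by
      ext c
      have : blk A a z (0, c) ∈ LinearMap.range (LinearMap.inl F W C) := by
        rw [← hr]; exact ⟨_, rfl⟩
      rw [mem_range_inl] at this
      simpa using this
    subst hz
    obtain ⟨B, b, d, rfl⟩ := exists_blk B (fun w => by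
      rw [← mem_range_inl (F := F), ← hr]
      have : (w, (0 : C)) ∈ LinearMap.range (LinearMap.inl F W C) := ⟨w, rfl⟩
      rw [← hr] at this
      obtain ⟨y, hy⟩ := this
      rw [← hy]
      exact ⟨B y, LinearMap.congr_fun hAB.2.2 y⟩)
    have := (pair_blk A B (a, b, d)).1 ⟨hAB, hr⟩
    exact ⟨⟨⟨(A, B), this.1⟩, ⟨(a, b, d), this.2⟩⟩, rfl⟩

lemma card_rp_prod :
    Nat.card {P : End F (W × C) × End F (W × C) // PairOK P ∧
      LinearMap.range P.1 = LinearMap.range (LinearMap.inl F W C)} =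
    ∑ s ∈ Finset.range (finrank F W + 1),
      hh F (finrank F W) s * extc F (finrank F W) (finrank F C) s := by
  classical
  have f1 := finV F (C →ₗ[F] W)
  have f2 := finV F (End F C)
  have f3 := finV F (End F W)
  have := Fintype.ofFinite {P : End F W × End F W // PairOK P}
  rw [card_rp_prod_sigma, Nat.card_sigma]
  rw [← Finset.sum_fiberwise_of_maps_to (t := Finset.range (finrank F W + 1))
    (g := fun P : {P : End F W × End F W // PairOK P} => finrank F (LinearMap.ker P.1.1))]
  · apply Finset.sum_congr rfl
    intro s hs
    rw [Finset.sum_congr rfl (g := fun _ => extc F (finrank F W) (finrank F C) s)]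
    · rw [Finset.sum_const, smul_eq_mul, ← card_pair]
      congr 1
      rw [← Fintype.card_subtype, ← Nat.card_eq_fintype_card]
      exact Nat.card_congr (Equiv.subtypeSubtypeEquivSubtypeInter
        (fun P : End F W × End F W => PairOK P) (fun P => finrank F (LinearMap.ker P.1) = s))
    · rintro ⟨⟨A, B⟩, hAB⟩ hU
      rw [card_ext' A B hAB]
      rw [(Finset.mem_filter.1 hU).2]
  · intro P _
    have := Submodule.finrank_le (LinearMap.ker P.1.1)
    simp only [Finset.mem_range]
    omega

lemma card_rp (U : Submodule F V) {m r : ℕ} (hU : finrank F U = m) (hV : finrank F V = m + r) :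
    Nat.card {P : End F V × End F V // PairOK P ∧ LinearMap.range P.1 = U} =
    ∑ s ∈ Finset.range (m + 1), hh F m s * extc F m r s := by
  obtain ⟨C, e, he, hf⟩ := exists_split U
  have hC : finrank F C = r := by omega
  have := card_rp_prod (F := F) (W := U) (C := C)
  rw [hU, hC] at this
  rw [← this]
  refine Nat.card_congr ((Equiv.prodCongr e.conjRingEquiv.toEquiv
    e.conjRingEquiv.toEquiv).subtypeEquiv (fun P => and_congr (pairOK_conj e P) ?_))
  show _ ↔ LinearMap.range (e.conjRingEquiv P.1) = _
  rw [range_conj, ← he]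
  exact (Submodule.map_injective_of_injective e.injective).eq_iff.symm

lemma hh_rec (m r : ℕ) : hh F (m + r) r =
    Nat.card {U : Submodule F (Fin (m + r) → F) // finrank F U = m} *
      ∑ s ∈ Finset.range (m + 1), hh F m s * extc F m r s := by
  have hfV := finV F (Fin (m + r) → F)
  have hfE := finV F (End F (Fin (m + r) → F))
  have hfS : Finite (Submodule F (Fin (m + r) → F)) := Finite.of_injective _ SetLike.coe_injective
  have hn : finrank F (Fin (m + r) → F) = m + r := by simp
  refine card_fib (fun P : {P : End F (Fin (m + r) → F) × End F (Fin (m + r) → F) //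
    PairOK P ∧ finrank F (LinearMap.ker P.1) = r} => (⟨LinearMap.range P.1.1, by
      have := P.2.2
      rw [finrank_ker_iff, hn] at this
      omega⟩ : {U : Submodule F (Fin (m + r) → F) // finrank F U = m})) _ ?_
  rintro ⟨U, hU⟩
  rw [← card_rp U hU hn]
  refine Nat.card_congr ⟨fun P => ⟨P.1.1, P.1.2.1, congrArg Subtype.val P.2⟩,
    fun P => ⟨⟨P.1, P.2.1, ?_⟩, Subtype.ext P.2.2⟩, fun P => rfl, fun P => rfl⟩
  rw [finrank_ker_iff, hn, P.2.2, hU]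

lemma hh_eq_zero {n r : ℕ} (h : n < r) : hh F n r = 0 := by
  unfold hh
  rw [Nat.card_eq_zero]
  left
  constructor
  rintro ⟨P, -, hP⟩
  have := Submodule.finrank_le (LinearMap.ker P.1)
  rw [hP] at this
  simp at this
  omega

lemma hh_zero_right {n : ℕ} (h : 0 < n) : hh F n 0 = 0 := by
  unfold hh
  rw [Nat.card_eq_zero]
  left
  constructor
  rintro ⟨P, hP, hk⟩
  have : Nonempty (Fin n) := ⟨⟨0, h⟩⟩
  have hi : Function.Injective P.1 := by
    rw [← LinearMap.ker_eq_bot]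
    exact Submodule.finrank_eq_zero.1 hk
  obtain ⟨k, hk⟩ := hP.1
  have h2 : Function.Injective (P.1 ^ k : End F (Fin n → F)) := by
    rw [Module.End.coe_pow]; exact hi.iterate k
  rw [hk] at h2
  have := @h2 (fun _ => 1) 0 rfl
  have := congrFun this ⟨0, h⟩
  simp at this

lemma hh_zero_zero : hh F 0 0 = 1 := by
  unfold hh
  rw [Nat.card_eq_one_iff_unique]
  constructor
  · infer_instance
  · refine ⟨⟨(0, 0), ⟨IsNilpotent.zero, IsNilpotent.zero, rfl⟩, ?_⟩⟩
    have := Submodule.finrank_le (LinearMap.ker (0 : End F (Fin 0 → F)))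
    simpa using this

lemma nil_pairs (n : ℕ) : Nat.card {P : Matrix (Fin n) (Fin n) F × Matrix (Fin n) (Fin n) F //
    IsNilpotent P.1 ∧ IsNilpotent P.2 ∧ P.1 * P.2 = P.2 * P.1} =
    ∑ r ∈ Finset.range (n + 1), hh F n r := by
  classical
  have hfE := finV F (End F (Fin n → F))
  have := Fintype.ofFinite {P : End F (Fin n → F) × End F (Fin n → F) // PairOK P}
  let e := (Matrix.toLinAlgEquiv' (R := F) (n := Fin n))
  have h1 : Nat.card {P : Matrix (Fin n) (Fin n) F × Matrix (Fin n) (Fin n) F //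
    IsNilpotent P.1 ∧ IsNilpotent P.2 ∧ P.1 * P.2 = P.2 * P.1} =
    Nat.card {P : End F (Fin n → F) × End F (Fin n → F) // PairOK P} := by
    refine Nat.card_congr ((Equiv.prodCongr e.toEquiv e.toEquiv).subtypeEquiv (fun P => ?_))
    show _ ↔ IsNilpotent (e P.1) ∧ IsNilpotent (e P.2) ∧ e P.1 * e P.2 = e P.2 * e P.1
    rw [IsNilpotent.map_iff e.injective, IsNilpotent.map_iff e.injective, ← map_mul, ← map_mul,
      e.injective.eq_iff]
  rw [h1, Nat.card_eq_fintype_card, ← Finset.card_univ,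
    Finset.card_eq_sum_card_fiberwise (t := Finset.range (n + 1))
    (f := fun P : {P : End F (Fin n → F) × End F (Fin n → F) // PairOK P} =>
      finrank F (LinearMap.ker P.1.1))]
  · apply Finset.sum_congr rfl
    intro r _
    rw [← Fintype.card_subtype, ← Nat.card_eq_fintype_card]
    exact Nat.card_congr (Equiv.subtypeSubtypeEquivSubtypeInter
      (fun P : End F (Fin n → F) × End F (Fin n → F) => PairOK P)
      (fun P => finrank F (LinearMap.ker P.1) = r))
  · intro P _
    have := Submodule.finrank_le (LinearMap.ker P.1.1)
    simp at this ⊢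
    omega

end Count4
end FF

namespace FF

open Module

lemma two_le_card (F : Type) [Field F] [Fintype F] : 2 ≤ Fintype.card F :=
  Fintype.one_lt_card

lemma gl_pos {q : ℕ} (hq : 2 ≤ q) (n : ℕ) : 0 < glOrder q n := by
  unfold glOrder
  apply Finset.prod_pos
  intro i hi
  rw [sub_pos]
  exact pow_lt_pow_right₀ (by exact_mod_cast (show 1 < q by omega)) (Finset.mem_range.1 hi)

lemma gl_split (q k j : ℕ) : (∏ i ∈ Finset.range k, ((q : ℝ) ^ (k + j) - (q : ℝ) ^ i)) *
    (q : ℝ) ^ (k * j) * glOrder q j = glOrder q (k + j) := by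
  unfold glOrder
  rw [Finset.prod_range_add, mul_assoc]
  congr 1
  have : (q : ℝ) ^ (k * j) = ∏ i ∈ Finset.range j, (q : ℝ) ^ k := by
    rw [Finset.prod_const, Finset.card_range, pow_mul]
  rw [this, ← Finset.prod_mul_distrib]
  apply Finset.prod_congr rfl
  intro i _
  rw [pow_add, pow_add]
  ring

lemma cast_prod {q k n : ℕ} (hq : 2 ≤ q) (h : k ≤ n) :
    ((∏ i ∈ Finset.range k, (q ^ n - q ^ i) : ℕ) : ℝ) =
    ∏ i ∈ Finset.range k, ((q : ℝ) ^ n - (q : ℝ) ^ i) := by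
  rw [Nat.cast_prod]
  apply Finset.prod_congr rfl
  intro i hi
  rw [Finset.mem_range] at hi
  rw [Nat.cast_sub (Nat.pow_le_pow_right (by omega) (by omega))]
  push_cast
  rfl

variable (F : Type) [Field F] [Fintype F]

/-- normalised nilpotent count -/
noncomputable def cc (n : ℕ) : ℝ := nilc F n / glOrder (Fintype.card F) n

/-- normalised pair count -/
noncomputable def HH (n r : ℕ) : ℝ := hh F n r / glOrder (Fintype.card F) n

lemma gr_real (k j : ℕ) :
    (Nat.card {U : Submodule F (Fin (k + j) → F) // finrank F U = k} : ℝ) *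
    glOrder (Fintype.card F) k * (Fintype.card F : ℝ) ^ (k * j) * glOrder (Fintype.card F) j =
    glOrder (Fintype.card F) (k + j) := by
  have h := card_gr (F := F) (V := Fin (k + j) → F) k
  have hn : finrank F (Fin (k + j) → F) = k + j := by simp
  rw [hn] at h
  have h' := congrArg (Nat.cast (R := ℝ)) h
  rw [Nat.cast_mul, cast_prod (two_le_card F) le_rfl,
    cast_prod (two_le_card F) (Nat.le_add_right k j)] at h'
  rw [← gl_split, ← h']
  rfl

lemma fit_real (n : ℕ) : (Fintype.card F : ℝ) ^ (n * n) / glOrder (Fintype.card F) n =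
    ∑ k ∈ Finset.range (n + 1), cc F k := by
  have hpos := gl_pos (two_le_card F)
  rw [← Finset.sum_range_reflect, div_eq_iff (hpos n).ne', Finset.sum_mul]
  have h := congrArg (Nat.cast (R := ℝ)) (fit_total (F := F) n)
  simp only [Nat.cast_sum, Nat.cast_mul, Nat.cast_pow] at h
  rw [h]
  apply Finset.sum_congr rfl
  intro k hk
  rw [Finset.mem_range] at hk
  obtain ⟨j, rfl⟩ := Nat.exists_eq_add_of_le (Nat.lt_succ_iff.1 hk)
  rw [cast_prod (two_le_card F) le_rfl]
  rw [show k + j + 1 - 1 - k = j by omega, show k + j - k = j by omega, ← gr_real, cc, mul_comm j k]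
  have := (hpos j).ne'
  have := (hpos k).ne'
  field_simp
  rw [glOrder]
  ring

lemma cc_zero : cc F 0 = 1 := by
  have := fit_real F 0
  simp [glOrder] at this
  exact this.symm

lemma gl_succ (q n : ℕ) : glOrder q (n + 1) = ((q : ℝ) ^ (n + 1) - 1) * (q : ℝ) ^ n * glOrder q n := by
  rw [add_comm n 1, ← gl_split]
  simp

lemma cc_pow (n : ℕ) : cc F n * (Fintype.card F : ℝ) ^ n =
    (Fintype.card F : ℝ) ^ (n * n) / glOrder (Fintype.card F) n := by
  have hpos := gl_pos (two_le_card F)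
  cases n with
  | zero => simp [cc_zero, glOrder]
  | succ n =>
    have h1 := fit_real F (n + 1)
    rw [Finset.sum_range_succ, ← fit_real] at h1
    have h2 : cc F (n + 1) = (Fintype.card F : ℝ) ^ (n * (n + 1)) /
        glOrder (Fintype.card F) (n + 1) := by
      rw [← sub_eq_iff_eq_add'] at h1
      rw [← h1]
      have := (hpos n).ne'
      have h3 := (hpos (n + 1)).ne'
      have : (Fintype.card F : ℝ) ^ (n * n) / glOrder (Fintype.card F) n =
        (Fintype.card F : ℝ) ^ (n * n) * (((Fintype.card F : ℝ) ^ (n + 1) - 1) *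
          (Fintype.card F : ℝ) ^ n) / glOrder (Fintype.card F) (n + 1) := by
        rw [div_eq_div_iff this h3, gl_succ]
        ring
      rw [this, ← sub_div]
      congr 1
      ring
    rw [h2]
    ring

lemma cc_rec (n : ℕ) : cc F (n + 1) * ((Fintype.card F : ℝ) ^ (n + 1) - 1) =
    cc F n * (Fintype.card F : ℝ) ^ n := by
  have h1 := fit_real F (n + 1)
  rw [Finset.sum_range_succ, ← fit_real, ← cc_pow, ← cc_pow] at h1
  linarith

lemma HH_nonneg (n r : ℕ) : 0 ≤ HH F n r :=
  div_nonneg (Nat.cast_nonneg _) (gl_pos (two_le_card F) n).le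

lemma HH_zero_zero : HH F 0 0 = 1 := by simp [HH, hh_zero_zero, glOrder]

lemma HH_zero_right {n : ℕ} (h : 0 < n) : HH F n 0 = 0 := by simp [HH, hh_zero_right h]

lemma HH_eq_zero {n r : ℕ} (h : n < r) : HH F n r = 0 := by simp [HH, hh_eq_zero h]

lemma HH_rec (m r : ℕ) : HH F (m + r) r =
    ∑ p ∈ Finset.HasAntidiagonal.antidiagonal r, HH F m p.1 * cc F p.2 := by
  have hpos := gl_pos (two_le_card F)
  rw [Finset.Nat.sum_antidiagonal_eq_sum_range_succ (fun i j => HH F m i * cc F j)]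
  rw [HH, hh_rec, div_eq_iff (hpos _).ne']
  simp only [Nat.cast_sum, Nat.cast_mul]
  rw [Finset.mul_sum, Finset.sum_mul]
  have e1 : ∀ s, r < s → extc F m r s = 0 := by
    intro s hs
    rw [extc, Finset.prod_eq_zero (i := r) (by simpa using hs) (by simp)]
    simp
  have e2 : ∀ s, m < s → HH F m s = 0 := fun s hs => HH_eq_zero F hs
  have e3 : ∀ s, m < s → hh F m s = 0 := fun s hs => hh_eq_zero hs
  rw [Finset.sum_subset (Finset.range_mono (show m + 1 ≤ m + r + 1 by omega)) (by
    intro s _ hs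
    rw [e3 s (by simpa using hs)]
    simp),
    ← Finset.sum_subset (Finset.range_mono (show r + 1 ≤ m + r + 1 by omega)) (by
    intro s _ hs
    rw [e1 s (by simpa using hs)]
    simp)]
  apply Finset.sum_congr rfl
  intro s hs
  rw [Finset.mem_range] at hs
  by_cases hsm : m < s
  · rw [e2 s hsm, e3 s hsm]
    simp
  obtain ⟨j, rfl⟩ := Nat.exists_eq_add_of_le (Nat.lt_succ_iff.1 hs)
  rw [extc, show s + j - s = j by omega]
  simp only [Nat.cast_mul, Nat.cast_pow]
  rw [cast_prod (two_le_card F) (by omega), ← gr_real, HH, cc, ← gl_split _ s j]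
  have hp : (Fintype.card F : ℝ) ^ (m * (s + j)) = (Fintype.card F : ℝ) ^ ((s + j) * (m - s)) *
      (Fintype.card F : ℝ) ^ ((s + j) * s) := by
    rw [← pow_add, ← mul_add, mul_comm, Nat.sub_add_cancel (by omega)]
  rw [hp]
  have := (hpos j).ne'
  have := (hpos m).ne'
  field_simp

end FF

namespace FF

open Filter Topology

section Euler

variable {Q : ℝ} {c : ℕ → ℝ}

lemma c_bound (hQ : 2 ≤ Q) (hc0 : c 0 = 1)
    (hc : ∀ n, c (n + 1) * (Q ^ (n + 1) - 1) = c n * Q ^ n) (n : ℕ) : 0 ≤ c n ∧ c n ≤ 1 := by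
  induction n with
  | zero => simp [hc0]
  | succ n ih =>
    have h1 : 1 ≤ Q ^ n := one_le_pow₀ (by linarith)
    have h2 : Q ^ n ≤ Q ^ (n + 1) - 1 := by rw [pow_succ]; nlinarith
    have h3 : 0 < Q ^ (n + 1) - 1 := by linarith
    have h4 : c (n + 1) = c n * Q ^ n / (Q ^ (n + 1) - 1) := by
      rw [← hc, mul_div_assoc, div_self h3.ne', mul_one]
    rw [h4]
    constructor
    · exact div_nonneg (mul_nonneg ih.1 (by linarith)) h3.le
    · rw [div_le_one h3]
      nlinarith [ih.1, ih.2]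

lemma c_summable (hcb : ∀ n, 0 ≤ c n ∧ c n ≤ 1) {x : ℝ} (hx : |x| < 1) :
    Summable (fun n => ‖c n * x ^ n‖) := by
  refine Summable.of_nonneg_of_le (fun n => norm_nonneg _) (fun n => ?_)
    (summable_geometric_of_lt_one (abs_nonneg x) hx)
  rw [norm_mul, norm_pow, Real.norm_eq_abs, Real.norm_eq_abs, abs_of_nonneg (hcb n).1]
  exact mul_le_of_le_one_left (by positivity) (hcb n).2

lemma C_bound (hc0 : c 0 = 1) (hcb : ∀ n, 0 ≤ c n ∧ c n ≤ 1) {x : ℝ} (hx : |x| ≤ 1 / 2) :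
    |∑' n, c n * x ^ n - 1| ≤ 2 * |x| := by
  have hx1 : |x| < 1 := by linarith
  have hs := c_summable hcb hx1
  rw [hs.of_norm.tsum_eq_zero_add]
  simp only [hc0, pow_zero, mul_one, add_sub_cancel_left]
  have hg := (summable_geometric_of_lt_one (abs_nonneg x) hx1).mul_left |x|
  have h1 : ‖∑' n, c (n + 1) * x ^ (n + 1)‖ ≤ ∑' n : ℕ, |x| * |x| ^ n := by
    refine tsum_of_norm_bounded hg.hasSum (fun n => ?_)
    rw [norm_mul, norm_pow, Real.norm_eq_abs, Real.norm_eq_abs, abs_of_nonneg (hcb _).1, ← pow_succ']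
    exact mul_le_of_le_one_left (by positivity) (hcb _).2
  rw [tsum_mul_left, tsum_geometric_of_lt_one (abs_nonneg x) hx1] at h1
  refine h1.trans ?_
  rw [mul_comm]
  gcongr
  rw [inv_le_comm₀ (by linarith) (by norm_num)]
  linarith

lemma C_tendsto (hc0 : c 0 = 1) (hcb : ∀ n, 0 ≤ c n ∧ c n ≤ 1) {y : ℕ → ℝ}
    (hy : ∀ n, |y n| ≤ 1 / 2) (hy0 : Tendsto y atTop (𝓝 0)) :
    Tendsto (fun n => ∑' k, c k * y n ^ k) atTop (𝓝 1) := by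
  rw [tendsto_iff_norm_sub_tendsto_zero]
  refine squeeze_zero (fun n => norm_nonneg _) (fun n => C_bound hc0 hcb (hy n)) ?_
  have := hy0.abs.const_mul 2
  simpa using this

lemma C_step (hQ : 2 ≤ Q) (hcb : ∀ n, 0 ≤ c n ∧ c n ≤ 1)
    (hc : ∀ n, c (n + 1) * (Q ^ (n + 1) - 1) = c n * Q ^ n) {x : ℝ} (hx : |x| < 1) :
    (∑' n, c n * x ^ n) * (1 - x / Q) = ∑' n, c n * (x / Q) ^ n := by
  have hs := (c_summable hcb hx).of_norm
  have hQ0 : 0 < Q := by linarith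
  have hx2 : |x / Q| < 1 := by
    rw [abs_div, abs_of_pos hQ0, div_lt_one hQ0]; linarith
  have hs2 := (c_summable hcb hx2).of_norm
  have h1 : (∑' n, c n * x ^ n) * (1 - x / Q) =
      ∑' n, c n * x ^ n - ∑' n, c n * x ^ n * (x / Q) := by
    rw [tsum_mul_right]; ring
  rw [h1, hs.tsum_eq_zero_add, hs2.tsum_eq_zero_add, add_sub_assoc,
    ← Summable.tsum_sub ((summable_nat_add_iff 1).2 hs) (hs.mul_right _)]
  simp only [pow_zero]
  congr 1
  apply tsum_congr
  intro n
  have h2 : c n = c (n + 1) * (Q ^ (n + 1) - 1) / Q ^ n := by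
    rw [hc]; field_simp
  rw [h2, div_pow, pow_succ Q, pow_succ x]
  field_simp
  ring

lemma C_iter (hQ : 2 ≤ Q) (hcb : ∀ n, 0 ≤ c n ∧ c n ≤ 1)
    (hc : ∀ n, c (n + 1) * (Q ^ (n + 1) - 1) = c n * Q ^ n) {x : ℝ} (hx : |x| < 1) (L : ℕ) :
    (∑' n, c n * x ^ n) * ∏ l ∈ Finset.range L, (1 - x * Q ^ (-(l : ℤ) - 1)) =
      ∑' n, c n * (x / Q ^ L) ^ n := by
  have hQ0 : 0 < Q := by linarith
  induction L with
  | zero => simp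
  | succ L ih =>
    have hx2 : |x / Q ^ L| < 1 := by
      rw [abs_div, abs_of_pos (pow_pos hQ0 L), div_lt_one (pow_pos hQ0 L)]
      exact hx.trans_le (one_le_pow₀ (by linarith))
    have e1 : x * Q ^ (-(L : ℤ) - 1) = x / Q ^ L / Q := by
      rw [zpow_sub₀ hQ0.ne', zpow_neg, zpow_natCast, zpow_one]
      field_simp
    rw [Finset.prod_range_succ, ← mul_assoc, ih, e1, C_step hQ hcb hc hx2, div_div, pow_succ]

lemma summable_x {u : ℝ} (hQ : 2 ≤ Q) (hu : |u| ≤ 1 / 2) :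
    Summable (fun il : ℕ × ℕ => ‖u ^ (il.1 + 1) * Q ^ (-(il.2 : ℤ) - 1)‖) := by
  have hQ0 : 0 < Q := by linarith
  have h1 : Summable (fun n : ℕ => (1 / 2 : ℝ) ^ (n + 1)) :=
    (summable_nat_add_iff 1).2 (summable_geometric_of_lt_one (by norm_num) (by norm_num))
  refine Summable.of_nonneg_of_le (fun n => norm_nonneg _) (fun n => ?_)
    (h1.mul_of_nonneg h1 (fun n => by positivity) (fun n => by positivity))
  rw [norm_mul, norm_pow, norm_zpow, Real.norm_eq_abs, Real.norm_eq_abs, abs_of_pos hQ0]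
  have e1 : Q ^ (-(n.2 : ℤ) - 1) = (1 / Q) ^ (n.2 + 1) := by
    rw [show (-(n.2 : ℤ) - 1) = -((n.2 + 1 : ℕ) : ℤ) by push_cast; ring, zpow_neg, zpow_natCast]
    simp
  rw [e1]
  gcongr

lemma x_small {u : ℝ} (hQ : 2 ≤ Q) (hu : |u| ≤ 1 / 2) (i l : ℕ) :
    |u ^ (i + 1) * Q ^ (-(l : ℤ) - 1)| ≤ 1 / 2 := by
  have hQ0 : 0 < Q := by linarith
  rw [abs_mul, abs_pow, abs_zpow, abs_of_pos hQ0]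
  have h1 : |u| ^ (i + 1) ≤ 1 / 2 := by
    rw [pow_succ]
    have : |u| ^ i ≤ 1 := pow_le_one₀ (abs_nonneg _) (by linarith)
    nlinarith [abs_nonneg u]
  have h2 : Q ^ (-(l : ℤ) - 1) ≤ 1 := zpow_le_one_of_nonpos₀ (by linarith) (by omega)
  have h3 : 0 < Q ^ (-(l : ℤ) - 1) := zpow_pos hQ0 _
  have : 0 ≤ |u| ^ (i + 1) := by positivity
  nlinarith

lemma multip_of {ι : Type} {x : ι → ℝ} (hx : Summable (fun i => ‖x i‖)) (h : ∀ i, |x i| ≤ 1 / 2) :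
    Multipliable (fun i => (1 - x i)⁻¹) := by
  have : (fun i => (1 - x i)⁻¹) = fun i => 1 + x i * (1 - x i)⁻¹ := by
    ext i
    have := abs_le.1 (h i)
    have : 1 - x i ≠ 0 := by linarith
    field_simp
    ring
  rw [this]
  apply multipliable_one_add_of_summable
  refine Summable.of_nonneg_of_le (fun n => norm_nonneg _) (fun i => ?_) (hx.mul_left 2)
  have := abs_le.1 (h i)
  have h1 : 0 < 1 - x i := by linarith
  rw [norm_mul, norm_inv, Real.norm_eq_abs (1 - x i), abs_of_pos h1, mul_comm]
  gcongr
  rw [inv_le_comm₀ h1 (by norm_num)]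
  linarith

lemma C_hasProd {u : ℝ} (hQ : 2 ≤ Q) (hc0 : c 0 = 1) (hcb : ∀ n, 0 ≤ c n ∧ c n ≤ 1)
    (hc : ∀ n, c (n + 1) * (Q ^ (n + 1) - 1) = c n * Q ^ n) (hu : |u| ≤ 1 / 2) (i : ℕ) :
    HasProd (fun l : ℕ => (1 - u ^ (i + 1) * Q ^ (-(l : ℤ) - 1))⁻¹)
      (∑' n, c n * (u ^ (i + 1)) ^ n) := by
  have hQ0 : 0 < Q := by linarith
  have hsum : Summable (fun l : ℕ => ‖u ^ (i + 1) * Q ^ (-(l : ℤ) - 1)‖) :=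
    (summable_x hQ hu).comp_injective (i := fun l => (i, l)) (fun a b h => by simpa using h)
  have hm := multip_of hsum (fun l => x_small hQ hu i l)
  have hx1 : |u ^ (i + 1)| ≤ 1 / 2 := by
    rw [abs_pow, pow_succ]
    have : |u| ^ i ≤ 1 := pow_le_one₀ (abs_nonneg _) (by linarith)
    nlinarith [abs_nonneg u]
  set x := u ^ (i + 1) with hx
  have hit := C_iter hQ hcb hc (x := x) (by linarith)
  have hlim : Tendsto (fun L : ℕ => ∑' n, c n * (x / Q ^ L) ^ n) atTop (𝓝 1) := by
    apply C_tendsto hc0 hcb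
    · intro L
      rw [abs_div, abs_of_pos (pow_pos hQ0 L)]
      exact (div_le_self (abs_nonneg _) (one_le_pow₀ (by linarith))).trans hx1
    · have := (tendsto_pow_atTop_atTop_of_one_lt (show 1 < Q by linarith))
      exact this.const_div_atTop x
  have h2 := hm.hasProd.tendsto_prod_nat
  have h3 := hlim.mul h2
  have h4 : ∀ L : ℕ, (∑' n, c n * (x / Q ^ L) ^ n) *
      ∏ l ∈ Finset.range L, (1 - x * Q ^ (-(l : ℤ) - 1))⁻¹ = ∑' n, c n * x ^ n := by
    intro L
    rw [← hit, mul_assoc, ← Finset.prod_mul_distrib, Finset.prod_eq_one, mul_one]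
    intro l _
    have := abs_le.1 (x_small hQ hu i l)
    rw [← hx] at this
    exact mul_inv_cancel₀ (by linarith)
  simp only [h4, one_mul] at h3
  rw [tendsto_nhds_unique tendsto_const_nhds h3]
  exact hm.hasProd

end Euler

end FF

namespace FF

open Filter Topology

section Phi

variable {Q : ℝ} {c : ℕ → ℝ} {H : ℕ → ℕ → ℝ}

lemma cauchy_HasSum {K : ℕ × ℕ → ℝ} {g : ℕ → ℝ} (hK : Summable (fun p => ‖K p‖))
    (hg : Summable (fun k => ‖g k‖)) :
    HasSum (fun p : ℕ × ℕ => ∑ a ∈ Finset.HasAntidiagonal.antidiagonal p.2, K (p.1, a.1) * g a.2)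
      ((∑' p, K p) * ∑' k, g k) := by
  have h1 : HasSum (fun x : (ℕ × ℕ) × ℕ => K x.1 * g x.2) ((∑' p, K p) * ∑' k, g k) := by
    rw [tsum_mul_tsum_of_summable_norm hK hg]
    exact (summable_mul_of_summable_norm hK hg).hasSum
  have h2 : HasSum (fun x : ℕ × (ℕ × ℕ) => K (x.1, x.2.1) * g x.2.2)
      ((∑' p, K p) * ∑' k, g k) :=
    (Equiv.prodAssoc ℕ ℕ ℕ).symm.hasSum_iff.2 h1
  let e : (Σ p : ℕ × ℕ, Finset.HasAntidiagonal.antidiagonal p.2) ≃ ℕ × (ℕ × ℕ) :=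
    { toFun := fun x => (x.1.1, x.2.1)
      invFun := fun y => ⟨(y.1, y.2.1 + y.2.2), ⟨y.2, by simp⟩⟩
      left_inv := by
        rintro ⟨⟨m, r⟩, ⟨a, ha⟩⟩
        have := Finset.HasAntidiagonal.mem_antidiagonal.1 ha
        simp only at this
        subst this
        rfl
      right_inv := fun y => rfl }
  have h3 := e.hasSum_iff.2 h2
  refine h3.sigma (fun p => ?_)
  have h4 := hasSum_fintype (fun a : Finset.HasAntidiagonal.antidiagonal p.2 =>
    K (p.1, a.1.1) * g a.1.2)
  rw [Finset.sum_coe_sort (Finset.HasAntidiagonal.antidiagonal p.2)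
    (fun a => K (p.1, a.1) * g a.2)] at h4
  exact h4

lemma key (hH : ∀ n r, n < r → H n r = 0)
    (hrec : ∀ m r, H (m + r) r =
      ∑ p ∈ Finset.HasAntidiagonal.antidiagonal r, H m p.1 * c p.2)
    (hcb : ∀ n, 0 ≤ c n ∧ c n ≤ 1) (w : ℕ → ℝ) {u z : ℝ} (hy : |u * z| < 1)
    (hs : Summable (fun p : ℕ × ℕ => ‖w p.1 * H p.1 p.2 * u ^ p.1 * (u * z) ^ p.2‖)) :
    HasSum (fun p : ℕ × ℕ => w (p.1 - p.2) * H p.1 p.2 * u ^ p.1 * z ^ p.2)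
      ((∑' p : ℕ × ℕ, w p.1 * H p.1 p.2 * u ^ p.1 * (u * z) ^ p.2) * ∑' k, c k * (u * z) ^ k) := by
  have h1 := cauchy_HasSum hs (c_summable hcb hy)
  have hinj : Function.Injective (fun p : ℕ × ℕ => (p.1 + p.2, p.2)) := by
    rintro ⟨a, b⟩ ⟨a', b'⟩ h
    simp only [Prod.mk.injEq] at h ⊢
    omega
  rw [← hinj.hasSum_iff]
  · convert h1 using 2 with p
    simp only [Function.comp]
    rw [hrec, Nat.add_sub_cancel, Finset.mul_sum, Finset.sum_mul, Finset.sum_mul]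
    refine Finset.sum_congr rfl (fun a ha => ?_)
    have := Finset.HasAntidiagonal.mem_antidiagonal.1 ha
    rw [← this]
    ring
  · rintro ⟨n, r⟩ h
    have : n < r := by
      by_contra h'
      apply h
      exact ⟨(n - r, r), Prod.ext (Nat.sub_add_cancel (not_lt.1 h')) rfl⟩
    simp [hH n r this]

/-- truncation weight -/
noncomputable def wt (N m : ℕ) : ℝ := if m < N then 1 else 0

lemma wt_nonneg (N m : ℕ) : 0 ≤ wt N m := by unfold wt; split <;> norm_num

lemma wt_summable (hH : ∀ n r, n < r → H n r = 0) (N : ℕ) (u z : ℝ) :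
    Summable (fun p : ℕ × ℕ => wt N p.1 * H p.1 p.2 * u ^ p.1 * z ^ p.2) := by
  apply summable_of_ne_finset_zero (s := Finset.range N ×ˢ Finset.range N)
  rintro ⟨n, r⟩ h
  by_cases hn : n < N
  · have : n < r := by
      by_contra h'
      apply h
      simp only [Finset.mem_product, Finset.mem_range]
      omega
    simp [hH n r this]
  · simp [wt, hn]

lemma trunc_bound (hH : ∀ n r, n < r → H n r = 0) (h0 : H 0 0 = 1)
    (hr0 : ∀ n, 0 < n → H n 0 = 0) (hpos : ∀ n r, 0 ≤ H n r)
    (hrec : ∀ m r, H (m + r) r =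
      ∑ p ∈ Finset.HasAntidiagonal.antidiagonal r, H m p.1 * c p.2)
    (hc0 : c 0 = 1) (hcb : ∀ n, 0 ≤ c n ∧ c n ≤ 1) {u : ℝ} (hu0 : 0 ≤ u) (hu : u ≤ 1 / 2)
    (N : ℕ) : ∀ z : ℝ, 0 ≤ z → z ≤ 1 →
    ∑' p : ℕ × ℕ, wt (N + 1) p.1 * H p.1 p.2 * u ^ p.1 * z ^ p.2 ≤ Real.exp (4 * (u * z)) := by
  induction N with
  | zero =>
    intro z hz hz1
    rw [tsum_eq_single (0, 0)]
    · simp [wt, h0]; positivity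
    · rintro ⟨n, r⟩ h
      by_cases hn : n = 0
      · subst hn
        have : 0 < r := by
          rcases Nat.eq_zero_or_pos r with h' | h'
          · subst h'; exact absurd rfl h
          · exact h'
        simp [hH 0 r this]
      · simp [wt, hn]
  | succ N ih =>
    intro z hz hz1
    have hy0 : 0 ≤ u * z := mul_nonneg hu0 hz
    have hy : u * z ≤ 1 / 2 := by nlinarith
    have hk := key hH hrec hcb (wt (N + 1)) (u := u) (z := z) (by rw [abs_of_nonneg hy0]; linarith)
      (wt_summable hH (N + 1) u (u * z)).norm
    have h1 : ∑' p : ℕ × ℕ, wt (N + 1 + 1) p.1 * H p.1 p.2 * u ^ p.1 * z ^ p.2 ≤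
        ∑' p : ℕ × ℕ, wt (N + 1) (p.1 - p.2) * H p.1 p.2 * u ^ p.1 * z ^ p.2 := by
      refine Summable.tsum_le_tsum ?_ (wt_summable hH _ u z) hk.summable
      rintro ⟨n, r⟩
      simp only
      by_cases hz : H n r = 0
      · simp [hz]
      · have hw : wt (N + 1 + 1) n ≤ wt (N + 1) (n - r) := by
          unfold wt
          by_cases hn : n < N + 1 + 1
          · have : n - r < N + 1 := by
              by_contra h'
              have hn0 : 0 < n := by omega
              have hr : r = 0 := by omega
              subst hr
              exact hz (hr0 n hn0)
            simp [hn, this]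
          · simp only [hn, if_false]; split <;> norm_num
        have := hpos n r
        gcongr
    rw [hk.tsum_eq] at h1
    refine h1.trans ?_
    have h2 := ih (u * z) hy0 (by linarith)
    have h3 : ∑' k, c k * (u * z) ^ k ≤ Real.exp (2 * (u * z)) := by
      have := C_bound hc0 hcb (x := u * z) (by rw [abs_of_nonneg hy0]; exact hy)
      rw [abs_of_nonneg hy0] at this
      have := (abs_le.1 this).2
      have := Real.add_one_le_exp (2 * (u * z))
      linarith
    have h4 : 0 ≤ ∑' k, c k * (u * z) ^ k :=
      tsum_nonneg (fun k => mul_nonneg (hcb k).1 (pow_nonneg hy0 k))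
    calc _ ≤ Real.exp (4 * (u * (u * z))) * Real.exp (2 * (u * z)) := by gcongr
      _ = Real.exp (4 * (u * (u * z)) + 2 * (u * z)) := by rw [Real.exp_add]
      _ ≤ _ := by
        apply Real.exp_le_exp.2
        nlinarith

lemma H_summable (hH : ∀ n r, n < r → H n r = 0) (h0 : H 0 0 = 1)
    (hr0 : ∀ n, 0 < n → H n 0 = 0) (hpos : ∀ n r, 0 ≤ H n r)
    (hrec : ∀ m r, H (m + r) r =
      ∑ p ∈ Finset.HasAntidiagonal.antidiagonal r, H m p.1 * c p.2)
    (hc0 : c 0 = 1) (hcb : ∀ n, 0 ≤ c n ∧ c n ≤ 1) {u : ℝ} (hu0 : 0 ≤ u) (hu : u ≤ 1 / 2) :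
    Summable (fun p : ℕ × ℕ => H p.1 p.2 * u ^ p.1) := by
  apply summable_of_sum_le (c := Real.exp (4 * (u * 1)))
  · intro p; exact mul_nonneg (hpos _ _) (pow_nonneg hu0 _)
  · intro s
    have hb := trunc_bound hH h0 hr0 hpos hrec hc0 hcb hu0 hu (s.sup Prod.fst) 1 zero_le_one le_rfl
    refine le_trans ?_ hb
    refine le_trans ?_ ((wt_summable hH (s.sup Prod.fst + 1) u 1).sum_le_tsum s (fun p _ => ?_))
    · refine (Finset.sum_congr rfl (fun p hp => ?_)).le
      have : p.1 ≤ s.sup Prod.fst := Finset.le_sup (f := Prod.fst) hp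
      have : p.1 < s.sup Prod.fst + 1 := by omega
      simp [wt, this]
    · have := hpos p.1 p.2
      have := wt_nonneg (s.sup Prod.fst + 1) p.1
      positivity

lemma Phi_summable (hpos : ∀ n r, 0 ≤ H n r) {u z : ℝ}
    (hs : Summable (fun p : ℕ × ℕ => H p.1 p.2 * |u| ^ p.1)) (hz : |z| ≤ 1) :
    Summable (fun p : ℕ × ℕ => ‖H p.1 p.2 * u ^ p.1 * z ^ p.2‖) := by
  refine Summable.of_nonneg_of_le (fun n => norm_nonneg _) (fun p => ?_) hs
  rw [norm_mul, norm_mul, norm_pow, norm_pow, Real.norm_eq_abs, Real.norm_eq_abs, Real.norm_eq_abs,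
    abs_of_nonneg (hpos _ _)]
  exact mul_le_of_le_one_right (mul_nonneg (hpos _ _) (by positivity))
    (pow_le_one₀ (abs_nonneg _) hz)

lemma Phi_iter (hH : ∀ n r, n < r → H n r = 0) (hpos : ∀ n r, 0 ≤ H n r)
    (hrec : ∀ m r, H (m + r) r =
      ∑ p ∈ Finset.HasAntidiagonal.antidiagonal r, H m p.1 * c p.2)
    (hcb : ∀ n, 0 ≤ c n ∧ c n ≤ 1) {u : ℝ} (hu : |u| ≤ 1 / 2)
    (hs : Summable (fun p : ℕ × ℕ => H p.1 p.2 * |u| ^ p.1)) (N : ℕ) :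
    ∑' p : ℕ × ℕ, H p.1 p.2 * u ^ p.1 =
      (∑' p : ℕ × ℕ, H p.1 p.2 * u ^ p.1 * (u ^ N) ^ p.2) *
        ∏ i ∈ Finset.range N, ∑' k, c k * (u ^ (i + 1)) ^ k := by
  induction N with
  | zero => simp
  | succ N ih =>
    have hz : |u ^ (N + 1)| ≤ 1 / 2 := by
      rw [abs_pow, pow_succ]
      have : |u| ^ N ≤ 1 := pow_le_one₀ (abs_nonneg _) (by linarith)
      nlinarith [abs_nonneg u]
    have hsum := Phi_summable hpos hs (z := u * u ^ N) (by rw [← pow_succ']; linarith)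
    have hk := key hH hrec hcb (fun _ => 1) (u := u) (z := u ^ N)
      (by rw [← pow_succ']; linarith) (by simpa only [one_mul] using hsum)
    simp only [one_mul, ← pow_succ'] at hk
    rw [ih, hk.tsum_eq, Finset.prod_range_succ]
    ring

lemma Phi_tendsto (h0 : H 0 0 = 1)
    (hr0 : ∀ n, 0 < n → H n 0 = 0) (hpos : ∀ n r, 0 ≤ H n r) {u : ℝ} (hu : |u| ≤ 1 / 2)
    (hs : Summable (fun p : ℕ × ℕ => H p.1 p.2 * |u| ^ p.1)) :
    Tendsto (fun N : ℕ => ∑' p : ℕ × ℕ, H p.1 p.2 * u ^ p.1 * (u ^ N) ^ p.2) atTop (𝓝 1) := by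
  have e : (1 : ℝ) = ∑' p : ℕ × ℕ, (if p = (0, 0) then (1 : ℝ) else 0) := by
    rw [tsum_ite_eq]
  rw [e]
  refine tendsto_tsum_of_dominated_convergence hs ?_ ?_
  · rintro ⟨n, r⟩
    rcases Nat.eq_zero_or_pos r with hr | hr
    · subst hr
      rcases Nat.eq_zero_or_pos n with hn | hn
      · subst hn; simp [h0]
      · simp [hr0 n hn, hn.ne']
    · have h1 : Tendsto (fun N : ℕ => u ^ N) atTop (𝓝 0) :=
        tendsto_pow_atTop_nhds_zero_of_abs_lt_one (by linarith)
      have h2 := (h1.pow r).const_mul (H n r * u ^ n)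
      simpa [hr.ne'] using h2
  · refine Eventually.of_forall (fun N p => ?_)
    rw [norm_mul, norm_mul, norm_pow, norm_pow, Real.norm_eq_abs, Real.norm_eq_abs,
      Real.norm_eq_abs, abs_of_nonneg (hpos _ _)]
    refine mul_le_of_le_one_right (mul_nonneg (hpos _ _) (by positivity))
      (pow_le_one₀ (abs_nonneg _) ?_)
    rw [abs_pow]
    exact pow_le_one₀ (abs_nonneg _) (by linarith)

lemma main_analytic (hQ : 2 ≤ Q) (hH : ∀ n r, n < r → H n r = 0) (h0 : H 0 0 = 1)
    (hr0 : ∀ n, 0 < n → H n 0 = 0) (hpos : ∀ n r, 0 ≤ H n r)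
    (hrec : ∀ m r, H (m + r) r =
      ∑ p ∈ Finset.HasAntidiagonal.antidiagonal r, H m p.1 * c p.2)
    (hc0 : c 0 = 1) (hc : ∀ n, c (n + 1) * (Q ^ (n + 1) - 1) = c n * Q ^ n)
    {u : ℝ} (hu : |u| ≤ 1 / 2) :
    Multipliable (fun il : ℕ × ℕ => (1 - u ^ (il.1 + 1) * Q ^ (-(il.2 : ℤ) - 1))⁻¹) ∧
    HasSum (fun n : ℕ => (∑ r ∈ Finset.range (n + 1), H n r) * u ^ n)
      (∏' il : ℕ × ℕ, (1 - u ^ (il.1 + 1) * Q ^ (-(il.2 : ℤ) - 1))⁻¹) := by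
  have hcb := c_bound hQ hc0 hc
  have hm : Multipliable (fun il : ℕ × ℕ => (1 - u ^ (il.1 + 1) * Q ^ (-(il.2 : ℤ) - 1))⁻¹) :=
    multip_of (summable_x hQ hu) (fun il => x_small hQ hu il.1 il.2)
  refine ⟨hm, ?_⟩
  have hp := hm.hasProd.prod_fiberwise (fun i => C_hasProd hQ hc0 hcb hc hu i)
  have hs := H_summable hH h0 hr0 hpos hrec hc0 hcb (abs_nonneg u) hu
  have h1 := (Phi_tendsto h0 hr0 hpos hu hs).mul hp.tendsto_prod_nat
  simp only [← Phi_iter hH hpos hrec hcb hu hs, one_mul] at h1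
  have h2 := tendsto_nhds_unique tendsto_const_nhds h1
  rw [← h2]
  have hs2 := (Phi_summable hpos hs (z := 1) (by simp)).of_norm
  simp only [one_pow, mul_one] at hs2
  refine hs2.hasSum.prod_fiberwise (fun n => ?_)
  rw [Finset.sum_mul]
  apply hasSum_sum_of_ne_finset_zero
  intro r hr
  simp only [Finset.mem_range, not_lt] at hr
  simp [hH n r (by omega)]

end Phi

end FF

theorem feit_fine_nilpotent
    (q : ℕ) (hq : ∃ p m : ℕ, p.Prime ∧ 0 < m ∧ q = p ^ m)
    (F : Type) [Field F] [Fintype F] (hF : Fintype.card F = q)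
    (u : ℝ) (hu : |u| < 1 / q) :
    Summable (fun n : ℕ => (nilCommPairs F n : ℝ) * u ^ n / glOrder q n) ∧
    Multipliable (fun il : ℕ × ℕ =>
      (1 - u ^ (il.1 + 1) * (q : ℝ) ^ (-(il.2 : ℤ) - 1))⁻¹) ∧
    ∑' n : ℕ, (nilCommPairs F n : ℝ) * u ^ n / glOrder q n =
      ∏' il : ℕ × ℕ, (1 - u ^ (il.1 + 1) * (q : ℝ) ^ (-(il.2 : ℤ) - 1))⁻¹ := by
  subst hF
  have hq2 := FF.two_le_card F
  have hQ : (2 : ℝ) ≤ (Fintype.card F : ℝ) := by exact_mod_cast hq2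
  have hu' : |u| ≤ 1 / 2 := hu.le.trans (one_div_le_one_div_of_le (by norm_num) hQ)
  obtain ⟨h1, h2⟩ := FF.main_analytic (c := FF.cc F) (H := FF.HH F) hQ
    (fun n r h => FF.HH_eq_zero F h) (FF.HH_zero_zero F) (fun n h => FF.HH_zero_right F h)
    (FF.HH_nonneg F) (FF.HH_rec F) (FF.cc_zero F) (FF.cc_rec F) hu'
  have e : (fun n : ℕ => (nilCommPairs F n : ℝ) * u ^ n / glOrder (Fintype.card F) n) =
      fun n : ℕ => (∑ r ∈ Finset.range (n + 1), FF.HH F n r) * u ^ n := by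
    funext n
    have e1 : nilCommPairs F n = ∑ r ∈ Finset.range (n + 1), FF.hh F n r := FF.nil_pairs n
    rw [e1]
    simp only [FF.HH]
    rw [← Finset.sum_div]
    push_cast
    ring
  rw [e]
  exact ⟨h2.summable, h1, h2.tsum_eq⟩
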